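/- For every integer n ≥ 3, θ_n < β_n ≤ α_{n+1} < θ_{n+1}, where α_n := 1 - 11/(8n) + 5/(8n²) and β_n := 1 - 11/(8n) + 11/(8n²); in particular θ_n < θ_{n+1} for n ≥ 3, assuming Hirschhorn's bounds α_n < θ_n < β_n. -/

import Mathlib

open Real

noncomputable def ramanujanTheta (n : ℕ) : ℝ :=
  30 * (((Nat.factorial n : ℝ) / (Real.sqrt π * ((n : ℝ) / Real.exp 1) ^ n)) ^ 6
    - 8 * (n : ℝ) ^ 3 - 4 * (n : ℝ) ^ 2 - (n : ℝ))

noncomputable def ramanujanAlpha (n : ℕ) : ℝ :=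
  1 - 11 / (8 * (n : ℝ)) + 5 / (8 * (n : ℝ) ^ 2)

noncomputable def ramanujanBeta (n : ℕ) : ℝ :=
  1 - 11 / (8 * (n : ℝ)) + 11 / (8 * (n : ℝ) ^ 2)

theorem theta_lt_succ_of_hirschhorn
    (hHirschhorn : ∀ m : ℕ, 0 < m →
      ramanujanAlpha m < ramanujanTheta m ∧ ramanujanTheta m < ramanujanBeta m)
    (n : ℕ) (hn : 3 ≤ n) :
    ramanujanTheta n < ramanujanBeta n ∧
    ramanujanBeta n ≤ ramanujanAlpha (n + 1) ∧
    ramanujanAlpha (n + 1) < ramanujanTheta (n + 1) := by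
  have hn' : (3 : ℝ) ≤ n := by exact_mod_cast hn
  refine ⟨(hHirschhorn n (by lia)).2, ?_, (hHirschhorn (n + 1) n.succ_pos).1⟩
  have gap : ramanujanAlpha (n + 1) - ramanujanBeta n
      = (5 * (n : ℝ) ^ 2 - 11 * n - 11) / (8 * (n : ℝ) ^ 2 * (n + 1) ^ 2) := by
    unfold ramanujanAlpha ramanujanBeta
    push_cast
    field_simp
    ring
  rw [← sub_nonneg, gap]
  exact div_nonneg (by nlinarith) (by positivity)
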